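/- Let H be a non-semisimple finite-dimensional Hopf algebra with left integral Λ. If z is a central element lying in the Higman ideal ad Λ(H), then f(z) = 0 for every left shifted trace-like functional f ∈ c_l(H) (i.e. every f with f(ab) = f(b S²(a))). -/

import Mathlib

open TensorProduct

/-- The left Hopf-adjoint action `ad h a = Σ h₁ a S(h₂)`. -/
noncomputable def ad {k H : Type*} [Field k] [Ring H] [HopfAlgebra k H] (h a : H) : H :=
  TensorProduct.lift ((LinearMap.mul k H).compl₂
      ((LinearMap.mulLeft k a).comp (HopfAlgebra.antipode (R := k))))
    (Coalgebra.comul (R := k) h)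

open Coalgebra HopfAlgebra in
theorem casimir_aux {k H : Type*} [Field k] [Ring H] [HopfAlgebra k H] (h u v m : H)
    (p : H →ₗ[k] H) :
    ∑ i ∈ (ℛ k h).index, ∑ j ∈ (ℛ k ((ℛ k h).left i)).index,
      (ℛ k ((ℛ k h).left i)).left j * u *
        p (antipode k ((ℛ k ((ℛ k h).left i)).right j * v) * ((ℛ k h).right i * m))
      = h * u * p (antipode k v * m) := by
  have key := sum_tmul_tmul_eq (R := k) (ℛ k h) (fun i => ℛ k ((ℛ k h).left i))
    (fun i => ℛ k ((ℛ k h).right i))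
  let g : H ⊗[k] H →ₗ[k] H :=
    p ∘ₗ LinearMap.mulLeft k (antipode k v) ∘ₗ LinearMap.mulRight k m ∘ₗ LinearMap.mul' k H ∘ₗ
      (antipode k).rTensor H
  let F : H ⊗[k] (H ⊗[k] H) →ₗ[k] H :=
    LinearMap.mul' k H ∘ₗ TensorProduct.map (LinearMap.mulRight k u) g
  have hF : ∀ a b c : H, F (a ⊗ₜ (b ⊗ₜ c)) = a * u * p (antipode k v * (antipode k b * c * m)) :=
    fun a b c => by simp [F, g]
  have key2 := congrArg F key
  simp only [map_sum, hF] at key2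
  calc _ = _ := ?_
    _ = _ := key2
    _ = _ := ?_
  · simp only [antipode_mul_antidistrib, mul_assoc]
  · simp only [← Finset.mul_sum, ← map_sum, ← Finset.sum_mul, sum_antipode_mul_eq_smul]
    simp only [smul_mul_assoc, one_mul, mul_smul_comm, map_smul]
    simp only [← smul_mul_assoc, ← Finset.sum_mul]
    congr 2
    have := congrArg (TensorProduct.rid k H) (sum_tmul_counit_eq (R := k) (ℛ k h))
    simpa only [map_sum, TensorProduct.rid_tmul, one_smul] using this

/-- The averaged map `m ↦ Σ y₁ p(S(y₂) m)`, linear in `y`. -/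
noncomputable def avg {k H : Type*} [Field k] [Ring H] [HopfAlgebra k H] (p : H →ₗ[k] H) (m : H) :
    H →ₗ[k] H :=
  LinearMap.mul' k H ∘ₗ TensorProduct.map LinearMap.id
    (p ∘ₗ LinearMap.mulRight k m ∘ₗ HopfAlgebra.antipode k) ∘ₗ Coalgebra.comul

open Coalgebra HopfAlgebra in
theorem avg_repr {k H : Type*} [Field k] [Ring H] [HopfAlgebra k H] (p : H →ₗ[k] H) (m y : H)
    {ι : Type*} (r : Repr k y ι) :
    avg p m y = ∑ i ∈ r.index, r.left i * p (antipode k (r.right i) * m) := by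
  simp [avg, ← r.eq]

open Coalgebra HopfAlgebra in
theorem avg_comm {k H : Type*} [Field k] [Ring H] [HopfAlgebra k H] (Λ : H)
    (hΛ : ∀ h : H, h * Λ = Coalgebra.counit (R := k) h • Λ) (p : H →ₗ[k] H) (m h : H) :
    avg p (h * m) Λ = h * avg p m Λ := by
  have hadd : ∀ y, avg p (h * m) y = ∑ i ∈ (ℛ k h).index,
      counit (R := k) ((ℛ k h).left i) • avg p ((ℛ k h).right i * m) y := by
    intro y
    conv_lhs => rw [← sum_counit_smul (R := k) (ℛ k h)]
    simp only [avg_repr p _ y (ℛ k y), Finset.sum_mul, Finset.mul_sum, map_sum, smul_mul_assoc,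
      mul_smul_comm, map_smul, Finset.smul_sum]
    rw [Finset.sum_comm]
  rw [hadd]
  simp only [← map_smul, ← hΛ]
  have hm : ∀ i, avg p ((ℛ k h).right i * m) ((ℛ k h).left i * Λ) =
      ∑ l ∈ (ℛ k Λ).index, ∑ j ∈ (ℛ k ((ℛ k h).left i)).index,
      (ℛ k ((ℛ k h).left i)).left j * (ℛ k Λ).left l *
        p (antipode k ((ℛ k ((ℛ k h).left i)).right j * (ℛ k Λ).right l) *
          ((ℛ k h).right i * m)) := by
    intro i
    rw [avg_repr p _ _ ((ℛ k ((ℛ k h).left i)).mul (ℛ k Λ)), Finset.sum_comm]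
    simp [Finset.sum_product]
  simp only [hm]
  rw [Finset.sum_comm]
  simp only [casimir_aux]
  rw [avg_repr p m Λ (ℛ k Λ), Finset.mul_sum]
  simp only [mul_assoc]

open Coalgebra HopfAlgebra in
theorem maschke {k H : Type*} [Field k] [Ring H] [HopfAlgebra k H] (Λ : H)
    (hΛ : ∀ h : H, h * Λ = Coalgebra.counit (R := k) h • Λ)
    (h0 : Coalgebra.counit (R := k) Λ ≠ 0) : IsSemisimpleRing H := by
  refine (isSemisimpleModule_iff H H).2 ⟨fun N => ?_⟩
  obtain ⟨p0, hp0⟩ := LinearMap.exists_leftInverse_of_injective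
    (N.restrictScalars k).subtype (Submodule.ker_subtype _)
  let p : H →ₗ[k] H := (N.restrictScalars k).subtype ∘ₗ p0
  have hpN : ∀ x, p x ∈ N := fun x => (p0 x).2
  have hpid : ∀ x ∈ N, p x = x := fun x hx =>
    congrArg Subtype.val (LinearMap.congr_fun hp0 ⟨x, hx⟩)
  let P : H →ₗ[H] H :=
    { toFun := fun m => (counit (R := k) Λ)⁻¹ • avg p m Λ
      map_add' := fun a b => by
        simp [avg_repr p _ Λ (ℛ k Λ), mul_add, Finset.sum_add_distrib]
      map_smul' := fun a b => by
        simp [avg_comm Λ hΛ] }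
  have hP : ∀ m, P m = (counit (R := k) Λ)⁻¹ • avg p m Λ := fun _ => rfl
  have hPN : ∀ m, P m ∈ N := by
    intro m
    rw [hP, avg_repr p _ Λ (ℛ k Λ)]
    refine (N.restrictScalars k).smul_mem _ (N.sum_mem fun i _ => N.smul_mem _ (hpN _))
  have hPid : ∀ m ∈ N, P m = m := by
    intro m hm
    rw [hP, avg_repr p _ Λ (ℛ k Λ)]
    have : ∀ i, p (antipode k ((ℛ k Λ).right i) * m) = antipode k ((ℛ k Λ).right i) * m :=
      fun i => hpid _ (N.smul_mem _ hm)
    simp only [this, ← mul_assoc, ← Finset.sum_mul, sum_mul_antipode_eq_smul]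
    simp [h0]
  exact ⟨_, LinearMap.isCompl_of_proj (f := P.codRestrict N hPN)
    (fun x => Subtype.ext (hPid x x.2))⟩

/-- let `H` be a non-semisimple finite-dimensional Hopf algebra with left
integral `Λ`.  If `z = ad Λ x` lies in the Higman ideal `ad Λ (H)`, then `f z = 0` for
every left shifted trace-like functional `f` (i.e. every `f` with `f(ab) = f(b S²(a))`). -/
theorem stmt_5 {k H : Type*} [Field k] [Ring H] [HopfAlgebra k H]
    [FiniteDimensional k H] (hss : ¬ IsSemisimpleRing H)
    (Λ : H) (hΛ : ∀ h : H, h * Λ = Coalgebra.counit (R := k) h • Λ)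
    (f : H →ₗ[k] k)
    (hf : ∀ a b : H,
      f (a * b) = f (b * HopfAlgebra.antipode (R := k) (HopfAlgebra.antipode (R := k) a)))
    (x : H) :
    f (ad (k := k) Λ x) = 0 := by
  have h0 : Coalgebra.counit (R := k) Λ = 0 := by
    by_contra h
    exact hss (maschke Λ hΛ h)
  have : ad (k := k) Λ x = ∑ i ∈ (Coalgebra.Repr.arbitrary k Λ).index,
      (Coalgebra.Repr.arbitrary k Λ).left i *
        (x * HopfAlgebra.antipode k ((Coalgebra.Repr.arbitrary k Λ).right i)) := by
    conv_lhs => rw [ad, ← (Coalgebra.Repr.arbitrary k Λ).eq]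
    simp
  rw [this, map_sum]
  have hterm : ∀ a b : H, f (a * (x * HopfAlgebra.antipode k b)) =
      f (x * HopfAlgebra.antipode k (HopfAlgebra.antipode k a * b)) := fun a b => by
    rw [hf, HopfAlgebra.antipode_mul_antidistrib, mul_assoc]
  simp only [hterm]
  rw [← map_sum, ← Finset.mul_sum, ← map_sum, HopfAlgebra.sum_antipode_mul_eq_smul, h0]
  simp
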